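/- arXiv:1808.09698 — 3 statements merged into one kernel-verified Lean document; each statement's English description precedes it below -/
import Mathlib

section
/- Let C be a copula that is negatively quadrant dependent, i.e. C(x,y) ≤ xy for all x,y ∈ [0,1]. Then for all x,y ∈ [0,1] one has |C(x,y) − C(y,x)| ≤ min{xy, (1−x)(1−y), |x−y|}. -/
/-- A (bivariate) copula: boundary conditions, values in [0,1], and 2-increasingness. -/
def IsCopula (C : ℝ → ℝ → ℝ) : Prop :=
  (∀ x ∈ Set.Icc (0:ℝ) 1, ∀ y ∈ Set.Icc (0:ℝ) 1, C x y ∈ Set.Icc (0:ℝ) 1) ∧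
  (∀ x ∈ Set.Icc (0:ℝ) 1, C x 0 = 0 ∧ C 0 x = 0 ∧ C x 1 = x ∧ C 1 x = x) ∧
  (∀ x₁ x₂ y₁ y₂ : ℝ, 0 ≤ x₁ → x₁ ≤ x₂ → x₂ ≤ 1 → 0 ≤ y₁ → y₁ ≤ y₂ → y₂ ≤ 1 →
    0 ≤ C x₂ y₂ - C x₂ y₁ - C x₁ y₂ + C x₁ y₁)

/-- The Fréchet–Hoeffding lower bound. -/
theorem IsCopula.add_sub_one_le {C : ℝ → ℝ → ℝ} (hC : IsCopula C) {x y : ℝ}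
    (hx : x ∈ Set.Icc (0:ℝ) 1) (hy : y ∈ Set.Icc (0:ℝ) 1) : x + y - 1 ≤ C x y := by
  obtain ⟨-, hb, hi⟩ := hC
  have h := hi x 1 y 1 hx.1 hx.2 le_rfl hy.1 hy.2 le_rfl
  have h1 := (hb 1 ⟨zero_le_one, le_rfl⟩).2.2.1
  have hx1 := (hb x hx).2.2.1
  have hy1 := (hb y hy).2.2.2
  linarith

/-- A copula is nondecreasing and 1-Lipschitz in its first argument. -/
theorem IsCopula.sub_left_mem_Icc {C : ℝ → ℝ → ℝ} (hC : IsCopula C) {x₁ x₂ y : ℝ}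
    (hx₁ : 0 ≤ x₁) (hx : x₁ ≤ x₂) (hx₂ : x₂ ≤ 1) (hy : y ∈ Set.Icc (0:ℝ) 1) :
    C x₂ y - C x₁ y ∈ Set.Icc 0 (x₂ - x₁) := by
  obtain ⟨-, hb, hi⟩ := hC
  obtain ⟨h10, -, h11, -⟩ := hb x₁ ⟨hx₁, hx.trans hx₂⟩
  obtain ⟨h20, -, h21, -⟩ := hb x₂ ⟨hx₁.trans hx, hx₂⟩
  have hlow := hi x₁ x₂ 0 y hx₁ hx hx₂ le_rfl hy.1 hy.2
  have hhigh := hi x₁ x₂ y 1 hx₁ hx hx₂ hy.1 hy.2 le_rfl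
  constructor <;> linarith

/-- A copula is nondecreasing and 1-Lipschitz in its second argument. -/
theorem IsCopula.sub_right_mem_Icc {C : ℝ → ℝ → ℝ} (hC : IsCopula C) {x y₁ y₂ : ℝ}
    (hy₁ : 0 ≤ y₁) (hy : y₁ ≤ y₂) (hy₂ : y₂ ≤ 1) (hx : x ∈ Set.Icc (0:ℝ) 1) :
    C x y₂ - C x y₁ ∈ Set.Icc 0 (y₂ - y₁) := by
  obtain ⟨-, hb, hi⟩ := hC
  obtain ⟨-, h10, -, h11⟩ := hb y₁ ⟨hy₁, hy.trans hy₂⟩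
  obtain ⟨-, h20, -, h21⟩ := hb y₂ ⟨hy₁.trans hy, hy₂⟩
  have hlow := hi 0 x y₁ y₂ le_rfl hx.1 hx.2 hy₁ hy hy₂
  have hhigh := hi x 1 y₁ y₂ hx.1 hx.2 le_rfl hy₁ hy hy₂
  constructor <;> linarith

theorem IsCopula.abs_sub_swap_le {C : ℝ → ℝ → ℝ} (hC : IsCopula C) {x y : ℝ}
    (hx : x ∈ Set.Icc (0:ℝ) 1) (hy : y ∈ Set.Icc (0:ℝ) 1) :
    |C x y - C y x| ≤ |x - y| := by
  wlog hxy : x ≤ y generalizing x y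
  · rw [abs_sub_comm, abs_sub_comm x]
    exact this hy hx (le_of_not_ge hxy)
  obtain ⟨hl, hl'⟩ := hC.sub_left_mem_Icc hx.1 hxy hy.2 hx
  obtain ⟨hr, hr'⟩ := hC.sub_right_mem_Icc hx.1 hxy hy.2 hx
  rw [abs_sub_comm x, abs_of_nonneg (sub_nonneg.2 hxy), abs_le]
  constructor <;> linarith

/-- for a negatively quadrant dependent copula `C`,
`|C(x,y) − C(y,x)| ≤ min{xy, (1−x)(1−y), |x−y|}` for all `x, y ∈ [0,1]`. -/
theorem nqd_maximal_asymmetry_bound (C : ℝ → ℝ → ℝ) (hC : IsCopula C)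
    (hNQD : ∀ x ∈ Set.Icc (0:ℝ) 1, ∀ y ∈ Set.Icc (0:ℝ) 1, C x y ≤ x * y) :
    ∀ x ∈ Set.Icc (0:ℝ) 1, ∀ y ∈ Set.Icc (0:ℝ) 1,
      |C x y - C y x| ≤ min (x * y) (min ((1 - x) * (1 - y)) |x - y|) := by
  intro x hx y hy
  have hxy := hNQD x hx y hy
  have hyx := hNQD y hy x hx
  refine le_min ?_ (le_min ?_ (hC.abs_sub_swap_le hx hy))
  · have hxy₀ := (hC.1 x hx y hy).1
    have hyx₀ := (hC.1 y hy x hx).1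
    rw [abs_le]
    constructor <;> linarith
  · have hxy₁ := hC.add_sub_one_le hx hy
    have hyx₁ := hC.add_sub_one_le hy hx
    rw [abs_le]
    constructor <;> linarith
end

section
/- Let C be a Marshall copula and p ∈ [1,∞). Then (∫₀¹∫₀¹ |C(x,y) − C(y,x)|^p dx dy)^{1/p} ≤ (2(2p+3)·B(p+1, 2p+3)/(p²+3p+2))^{1/p}, where B(α,β) = ∫₀¹ t^{α−1}(1−t)^{β−1} dt is the Beta function. In particular, ∫₀¹∫₀¹ |C(x,y) − C(y,x)| dx dy ≤ 1/18 and (∫₀¹∫₀¹ |C(x,y) − C(y,x)|² dx dy)^{1/2} ≤ 1/(6√6). -/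
/-- A Marshall copula: `C(x,y) = min{y·f(x), x·g(y)}` on `[0,1]²` for some nondecreasing
generators `f, g : [0,1] → [0,1]` with `f(0) = g(0) = 0`, `f(1) = g(1) = 1`, and
`f(x)/x`, `g(x)/x` nonincreasing on `(0,1]`. -/
def IsMarshallCopula (C : ℝ → ℝ → ℝ) : Prop :=
  ∃ f g : ℝ → ℝ,
    (∀ x ∈ Set.Icc (0:ℝ) 1, f x ∈ Set.Icc (0:ℝ) 1) ∧
    (∀ x ∈ Set.Icc (0:ℝ) 1, g x ∈ Set.Icc (0:ℝ) 1) ∧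
    MonotoneOn f (Set.Icc 0 1) ∧ MonotoneOn g (Set.Icc 0 1) ∧
    f 0 = 0 ∧ g 0 = 0 ∧ f 1 = 1 ∧ g 1 = 1 ∧
    AntitoneOn (fun x => f x / x) (Set.Ioc 0 1) ∧
    AntitoneOn (fun x => g x / x) (Set.Ioc 0 1) ∧
    (∀ x ∈ Set.Icc (0:ℝ) 1, ∀ y ∈ Set.Icc (0:ℝ) 1, C x y = min (y * f x) (x * g y))

/-- The Beta function `B(α,β) = ∫₀¹ t^{α−1}(1−t)^{β−1} dt`. -/
noncomputable def betaFn (α β : ℝ) : ℝ :=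
  ∫ t in (0:ℝ)..1, t ^ (α - 1) * (1 - t) ^ (β - 1)

open MeasureTheory Set

/-- The one-sided form of the pointwise bound on the asymmetry of a Marshall copula, in terms of the
values `a = f x`, `c = g x`, `b = f y`, `d = g y` of the generators at two points `y ≤ x`. -/
lemma min_sub_min_le_of_generator_values {x y a b c d : ℝ} (hy : 0 < y) (hyx : y ≤ x) (hx1 : x ≤ 1)
    (ha : a ≤ 1) (hdc : d ≤ c) (hab : y * a ≤ x * b) (hc : x ≤ c) :
    min (y * a) (x * d) - min (x * b) (y * c) ≤ y * min (1 - x) (1 - y / x) := by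
  have hx : 0 < x := hy.trans_le hyx
  have hyc : y / x ≤ 1 := (div_le_one hx).2 hyx
  rw [mul_min_of_nonneg _ _ hy.le]
  rcases le_total (x * b) (y * c) with h | h
  · rw [min_eq_left h]
    have h0 : min (y * a) (x * d) - x * b ≤ 0 := by
      linarith [min_le_left (y * a) (x * d)]
    exact h0.trans (le_min (mul_nonneg hy.le (by linarith)) (mul_nonneg hy.le (by linarith)))
  · rw [min_eq_right h]
    have h1 : min (y * a) (x * d) - y * c ≤ y * (1 - c) := by
      nlinarith [min_le_left (y * a) (x * d)]
    have h2 : min (y * a) (x * d) - y * c ≤ c * (x - y) := by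
      nlinarith [min_le_right (y * a) (x * d)]
    refine le_min (h1.trans (by gcongr)) ?_
    rcases le_total (y / x) c with hr | hr
    · exact h1.trans (by gcongr)
    · have e : y / x * (x - y) = y * (1 - y / x) := by field_simp
      rw [← e]
      exact h2.trans (mul_le_mul_of_nonneg_right hr (by linarith))

lemma IsMarshallCopula.abs_sub_swap_le {C : ℝ → ℝ → ℝ} (hC : IsMarshallCopula C) {x y : ℝ}
    (hy : 0 < y) (hyx : y ≤ x) (hx1 : x ≤ 1) :
    |C x y - C y x| ≤ y * min (1 - x) (1 - y / x) := by
  obtain ⟨f, g, hf, hg, hfm, hgm, -, -, hf1, hg1, hfa, hga, hCfg⟩ := hC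
  have hx : 0 < x := hy.trans_le hyx
  have hxI : x ∈ Icc (0 : ℝ) 1 := ⟨hx.le, hx1⟩
  have hyI : y ∈ Icc (0 : ℝ) 1 := ⟨hy.le, hyx.trans hx1⟩
  have key : ∀ h : ℝ → ℝ, h 1 = 1 → AntitoneOn (fun x => h x / x) (Ioc 0 1) →
      y * h x ≤ x * h y ∧ x ≤ h x := by
    intro h h1 ha
    have e1 := ha ⟨hy, hyI.2⟩ ⟨hx, hx1⟩ hyx
    have e2 := ha ⟨hx, hx1⟩ ⟨one_pos, le_rfl⟩ hx1
    simp only [h1, div_one] at e1 e2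
    rw [div_le_div_iff₀ hx hy] at e1
    rw [one_le_div hx] at e2
    exact ⟨by linarith, e2⟩
  have hfk := key f hf1 hfa
  have hgk := key g hg1 hga
  rw [hCfg x hxI y hyI, hCfg y hyI x hxI, abs_le']
  refine ⟨min_sub_min_le_of_generator_values hy hyx hx1 (hf x hxI).2 (hgm hyI hxI hyx) hfk.1 hgk.2,
    ?_⟩
  have := min_sub_min_le_of_generator_values hy hyx hx1 (hg x hxI).2 (hfm hyI hxI hyx) hgk.1 hfk.2
  rw [min_comm (y * g x), min_comm (x * g y)] at this
  linarith

/-- The restriction of Lebesgue measure to the unit interval. -/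
noncomputable abbrev unitMeasure : Measure ℝ := volume.restrict (Ioc 0 1)

lemma ae_prod_unitMeasure_mem :
    ∀ᵐ z ∂(unitMeasure.prod unitMeasure), z.1 ∈ Ioc (0 : ℝ) 1 ∧ z.2 ∈ Ioc (0 : ℝ) 1 := by
  rw [Measure.prod_restrict]
  filter_upwards [ae_restrict_mem (measurableSet_Ioc.prod measurableSet_Ioc)] with z hz
  exact hz

lemma integrable_prod_unitMeasure {h : ℝ × ℝ → ℝ} (hm : Measurable h)
    (h01 : ∀ x ∈ Ioc (0 : ℝ) 1, ∀ y ∈ Ioc (0 : ℝ) 1, h (x, y) ∈ Icc (0 : ℝ) 1) :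
    Integrable h (unitMeasure.prod unitMeasure) := by
  refine Integrable.of_bound hm.aestronglyMeasurable 1 ?_
  filter_upwards [ae_prod_unitMeasure_mem] with z hz
  obtain ⟨h0, h1⟩ := h01 z.1 hz.1 z.2 hz.2
  rw [Real.norm_eq_abs, abs_of_nonneg h0]
  exact h1

lemma setIntegral_ite_le_eq (k : ℝ → ℝ) {x : ℝ} (hx : x ∈ Ioc (0 : ℝ) 1) :
    ∫ y, (if y ≤ x then k y else 0) ∂unitMeasure = ∫ y in (0 : ℝ)..x, k y := by
  have e : (fun y => if y ≤ x then k y else 0) = (Iic x).indicator k := by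
    ext y; simp [indicator_apply]
  rw [e, integral_indicator measurableSet_Iic, Measure.restrict_restrict measurableSet_Iic,
    intervalIntegral.integral_of_le hx.1.le, inter_comm, Ioc_inter_Iic, min_eq_right hx.2]

lemma setIntegral_ite_le_rpow {q x : ℝ} (hq : 0 ≤ q) (hx : x ∈ Ioc (0 : ℝ) 1) :
    ∫ y, (if y ≤ x then y ^ q else 0) ∂unitMeasure = x ^ (q + 1) / (q + 1) := by
  rw [setIntegral_ite_le_eq _ hx, integral_rpow (Or.inl (by linarith)),
    Real.zero_rpow (by linarith), sub_zero]

/-- The `p`-th power of the largest possible asymmetry at a point below the diagonal. -/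
noncomputable def asymmetryKernel (p : ℝ) (z : ℝ × ℝ) : ℝ :=
  if z.2 ≤ z.1 then (z.2 * min (1 - z.1) (1 - z.2 / z.1)) ^ p else 0

lemma measurable_asymmetryKernel (p : ℝ) : Measurable (asymmetryKernel p) := by
  refine Measurable.ite (measurableSet_le measurable_snd measurable_fst) ?_ measurable_const
  fun_prop

lemma asymmetryKernel_mem_Icc {p x y : ℝ} (hp : 0 ≤ p) (hx : x ∈ Ioc (0 : ℝ) 1)
    (hy : y ∈ Ioc (0 : ℝ) 1) : asymmetryKernel p (x, y) ∈ Icc (0 : ℝ) 1 := by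
  unfold asymmetryKernel
  split_ifs with h
  · have hyx : y / x ≤ 1 := (div_le_one hx.1).2 h
    have h0 : 0 ≤ min (1 - x) (1 - y / x) := le_min (by linarith [hx.2]) (by linarith)
    have h1 : min (1 - x) (1 - y / x) ≤ 1 := (min_le_left _ _).trans (by linarith [hx.1])
    have h2 : 0 ≤ y * min (1 - x) (1 - y / x) := mul_nonneg hy.1.le h0
    exact ⟨Real.rpow_nonneg h2 _, Real.rpow_le_one h2 (mul_le_one₀ hy.2 h0 h1) hp⟩
  · simp

lemma IsMarshallCopula.rpow_le_kernel {C : ℝ → ℝ → ℝ} (hC : IsMarshallCopula C) {p x y : ℝ}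
    (hp : 0 ≤ p) (hx : x ∈ Ioc (0 : ℝ) 1) (hy : y ∈ Ioc (0 : ℝ) 1) :
    |C x y - C y x| ^ p ≤ asymmetryKernel p (x, y) + asymmetryKernel p (y, x) := by
  have main : ∀ {x y : ℝ}, x ∈ Ioc (0 : ℝ) 1 → y ∈ Ioc (0 : ℝ) 1 → y ≤ x →
      |C x y - C y x| ^ p ≤ asymmetryKernel p (x, y) := by
    intro x y hx hy h
    simp only [asymmetryKernel, if_pos h]
    exact Real.rpow_le_rpow (abs_nonneg _) (hC.abs_sub_swap_le hy.1 h hx.2) hp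
  rcases le_total y x with h | h
  · linarith [main hx hy h, (asymmetryKernel_mem_Icc hp hy hx).1]
  · rw [abs_sub_comm]
    linarith [main hy hx h, (asymmetryKernel_mem_Icc hp hx hy).1]

lemma IsMarshallCopula.integral_rpow_le_kernel {C : ℝ → ℝ → ℝ} (hC : IsMarshallCopula C) {p : ℝ}
    (hp : 0 ≤ p) :
    ∫ x in (0 : ℝ)..1, ∫ y in (0 : ℝ)..1, |C x y - C y x| ^ p ≤
      2 * ∫ x, ∫ y, asymmetryKernel p (x, y) ∂unitMeasure ∂unitMeasure := by
  have hi := integrable_prod_unitMeasure (measurable_asymmetryKernel p)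
    fun x hx y hy => asymmetryKernel_mem_Icc hp hx hy
  have hs : Integrable (fun z : ℝ × ℝ => asymmetryKernel p z.swap)
      (unitMeasure.prod unitMeasure) := hi.swap
  have hadd := hi.add hs
  have e : 2 * ∫ x, ∫ y, asymmetryKernel p (x, y) ∂unitMeasure ∂unitMeasure =
      ∫ x, ∫ y, (asymmetryKernel p (x, y) + asymmetryKernel p (y, x)) ∂unitMeasure ∂unitMeasure := by
    refine Eq.trans ?_ (integral_prod _ hadd)
    rw [← integral_prod _ hi, integral_add' hi hs, integral_prod_swap (asymmetryKernel p), two_mul]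
  rw [e]
  simp only [intervalIntegral.integral_of_le zero_le_one]
  refine integral_mono_of_nonneg (.of_forall fun x => integral_nonneg fun y => by positivity)
    hadd.integral_prod_left ?_
  filter_upwards [ae_restrict_mem measurableSet_Ioc, hadd.prod_right_ae] with x hx hxi
  refine integral_mono_of_nonneg (.of_forall fun y => by positivity) hxi ?_
  filter_upwards [ae_restrict_mem measurableSet_Ioc] with y hy
  exact hC.rpow_le_kernel hp hx hy

lemma integral_asymmetryKernel {p x : ℝ} (hx : x ∈ Ioc (0 : ℝ) 1) :
    ∫ y, asymmetryKernel p (x, y) ∂unitMeasure =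
      x ^ (p + 1) * ∫ t, t ^ p * (1 - max x t) ^ p ∂unitMeasure := by
  have h0 := intervalIntegral.smul_integral_comp_mul_left (a := 0) (b := 1)
    (fun y => (y * min (1 - x) (1 - y / x)) ^ p) x
  simp only [mul_zero, mul_one, smul_eq_mul] at h0
  simp only [asymmetryKernel]
  rw [setIntegral_ite_le_eq _ hx, ← h0, Real.rpow_add_one hx.1.ne', mul_comm (x ^ p), mul_assoc,
    intervalIntegral.integral_of_le zero_le_one, ← integral_const_mul (x ^ p)]
  congr 1
  refine setIntegral_congr_fun (measurableSet_Ioc (a := (0 : ℝ))) fun t ht => ?_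
  have hm : max x t ≤ 1 := max_le hx.2 ht.2
  rw [mul_div_cancel_left₀ _ hx.1.ne', min_sub_sub_left,
    Real.mul_rpow (mul_nonneg hx.1.le ht.1.le) (by linarith), Real.mul_rpow hx.1.le ht.1.le,
    mul_assoc]

/-- The product of `x ^ a * (1 - x) ^ p` and `t ^ q`, cut off above the diagonal. -/
noncomputable def triangleKernel (p a q : ℝ) (z : ℝ × ℝ) : ℝ :=
  z.1 ^ a * (1 - z.1) ^ p * (if z.2 ≤ z.1 then z.2 ^ q else 0)

lemma measurable_triangleKernel (p a q : ℝ) : Measurable (triangleKernel p a q) := by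
  refine Measurable.mul (by fun_prop) ?_
  exact Measurable.ite (measurableSet_le measurable_snd measurable_fst) (by fun_prop)
    measurable_const

lemma triangleKernel_mem_Icc {p a q x t : ℝ} (hp : 0 ≤ p) (ha : 0 ≤ a) (hq : 0 ≤ q)
    (hx : x ∈ Ioc (0 : ℝ) 1) (ht : t ∈ Ioc (0 : ℝ) 1) :
    triangleKernel p a q (x, t) ∈ Icc (0 : ℝ) 1 := by
  have key : ∀ {s r : ℝ}, 0 ≤ s → s ≤ 1 → 0 ≤ r → s ^ r ∈ Icc (0 : ℝ) 1 := fun h0 h1 hr =>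
    ⟨Real.rpow_nonneg h0 _, Real.rpow_le_one h0 h1 hr⟩
  refine unitInterval.mul_mem (unitInterval.mul_mem (key hx.1.le hx.2 ha)
    (key (by simpa using hx.2) (by simpa using hx.1.le) hp)) ?_
  simp only
  split_ifs
  · exact key ht.1.le ht.2 hq
  · simp

lemma integrable_triangleKernel {p a q : ℝ} (hp : 0 ≤ p) (ha : 0 ≤ a) (hq : 0 ≤ q) :
    Integrable (triangleKernel p a q) (unitMeasure.prod unitMeasure) :=
  integrable_prod_unitMeasure (measurable_triangleKernel p a q)
    fun _ hx _ ht => triangleKernel_mem_Icc hp ha hq hx ht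

lemma integral_triangleKernel {p a q : ℝ} (hp : 0 ≤ p) (ha : 0 ≤ a) (hq : 0 ≤ q) :
    ∫ z, triangleKernel p a q z ∂(unitMeasure.prod unitMeasure) =
      1 / (q + 1) * ∫ x in (0 : ℝ)..1, x ^ (a + q + 1) * (1 - x) ^ p := by
  rw [integral_prod _ (integrable_triangleKernel hp ha hq),
    intervalIntegral.integral_of_le zero_le_one, ← integral_const_mul]
  refine setIntegral_congr_fun measurableSet_Ioc fun x hx => ?_
  simp only [triangleKernel]
  rw [integral_const_mul, setIntegral_ite_le_rpow hq hx, add_assoc,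
    Real.rpow_add hx.1 a]
  ring

lemma rpow_mul_max_le_triangleKernel {p x t : ℝ} (hp : 0 ≤ p) (hx : x ∈ Ioc (0 : ℝ) 1)
    (ht : t ∈ Ioc (0 : ℝ) 1) :
    x ^ (p + 1) * (t ^ p * (1 - max x t) ^ p) ≤
      triangleKernel p (p + 1) p (x, t) + triangleKernel p p (p + 1) (t, x) := by
  have h1 := (triangleKernel_mem_Icc hp (by linarith : 0 ≤ p + 1) hp hx ht).1
  have h2 := (triangleKernel_mem_Icc hp hp (by linarith : 0 ≤ p + 1) ht hx).1
  rcases le_total t x with h | h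
  · refine le_add_of_le_of_nonneg (le_of_eq ?_) h2
    simp only [triangleKernel, if_pos h, max_eq_left h]
    ring
  · refine le_add_of_nonneg_of_le h1 (le_of_eq ?_)
    simp only [triangleKernel, if_pos h, max_eq_right h]
    ring

lemma integral_asymmetryKernel_le {p : ℝ} (hp : 0 ≤ p) :
    ∫ x, ∫ y, asymmetryKernel p (x, y) ∂unitMeasure ∂unitMeasure ≤
      (1 / (p + 1) + 1 / (p + 2)) * ∫ x in (0 : ℝ)..1, x ^ (2 * p + 2) * (1 - x) ^ p := by
  have hp1 : 0 ≤ p + 1 := by linarith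
  have hi := integrable_triangleKernel hp hp1 hp
  have hj := integrable_triangleKernel hp hp hp1
  have hs : Integrable (fun z : ℝ × ℝ => triangleKernel p p (p + 1) z.swap)
      (unitMeasure.prod unitMeasure) := hj.swap
  have hadd := hi.add hs
  have e : (1 / (p + 1) + 1 / (p + 2)) * ∫ x in (0 : ℝ)..1, x ^ (2 * p + 2) * (1 - x) ^ p =
      ∫ x, ∫ t, (triangleKernel p (p + 1) p (x, t) + triangleKernel p p (p + 1) (t, x))
        ∂unitMeasure ∂unitMeasure := by
    refine Eq.trans ?_ (integral_prod _ hadd)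
    rw [integral_add' hi hs, integral_prod_swap (triangleKernel p p (p + 1)),
      integral_triangleKernel hp hp1 hp, integral_triangleKernel hp hp hp1, add_mul]
    ring_nf
  rw [e]
  refine integral_mono_of_nonneg ?_ hadd.integral_prod_left ?_
  · filter_upwards [ae_restrict_mem measurableSet_Ioc] with x hx
    exact setIntegral_nonneg measurableSet_Ioc fun y hy => (asymmetryKernel_mem_Icc hp hx hy).1
  filter_upwards [ae_restrict_mem measurableSet_Ioc, hadd.prod_right_ae] with x hx hxi
  rw [integral_asymmetryKernel hx, ← integral_const_mul]
  refine integral_mono_of_nonneg ?_ hxi ?_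
  · filter_upwards [ae_restrict_mem measurableSet_Ioc] with t ht
    have hm : 0 ≤ 1 - max x t := sub_nonneg.2 (max_le hx.2 ht.2)
    have := hx.1.le
    have := ht.1.le
    simp only [Pi.zero_apply]
    positivity
  · filter_upwards [ae_restrict_mem measurableSet_Ioc] with t ht
    exact rpow_mul_max_le_triangleKernel hp hx ht

lemma IsMarshallCopula.integral_rpow_le {C : ℝ → ℝ → ℝ} (hC : IsMarshallCopula C) {p : ℝ}
    (hp : 0 ≤ p) :
    ∫ x in (0 : ℝ)..1, ∫ y in (0 : ℝ)..1, |C x y - C y x| ^ p ≤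
      2 * ((1 / (p + 1) + 1 / (p + 2)) *
        ∫ x in (0 : ℝ)..1, x ^ (2 * p + 2) * (1 - x) ^ p) :=
  (hC.integral_rpow_le_kernel hp).trans (by gcongr; exact integral_asymmetryKernel_le hp)

lemma betaFn_add_one (a b : ℝ) :
    betaFn (a + 1) (b + 1) = ∫ x in (0 : ℝ)..1, x ^ b * (1 - x) ^ a := by
  have h := intervalIntegral.integral_comp_sub_left (a := 0) (b := 1)
    (fun x : ℝ => x ^ b * (1 - x) ^ a) 1
  simp only [sub_sub_cancel, sub_self, sub_zero] at h
  rw [← h, betaFn]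
  simp only [add_sub_cancel_right, mul_comm]

/-- Observation 4.6: for a Marshall copula `C` and `p ∈ [1,∞)`,
`μ_p(C) ≤ (2(2p+3)B(p+1, 2p+3)/(p²+3p+2))^{1/p}`; in particular `μ₁(C) ≤ 1/18`
and `μ₂(C) ≤ 1/(6√6)`. -/
theorem marshall_mu_p_bound (C : ℝ → ℝ → ℝ) (hC : IsMarshallCopula C)
    (p : ℝ) (hp : 1 ≤ p) :
    (∫ x in (0:ℝ)..1, ∫ y in (0:ℝ)..1, |C x y - C y x| ^ p) ^ (1 / p) ≤
      (2 * (2 * p + 3) * betaFn (p + 1) (2 * p + 3) / (p ^ 2 + 3 * p + 2)) ^ (1 / p) ∧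
    (∫ x in (0:ℝ)..1, ∫ y in (0:ℝ)..1, |C x y - C y x|) ≤ 1 / 18 ∧
    Real.sqrt (∫ x in (0:ℝ)..1, ∫ y in (0:ℝ)..1, |C x y - C y x| ^ 2) ≤
      1 / (6 * Real.sqrt 6) := by
  refine ⟨?_, ?_, ?_⟩
  · refine Real.rpow_le_rpow ?_ ?_ (by positivity)
    · exact intervalIntegral.integral_nonneg zero_le_one fun x _ =>
        intervalIntegral.integral_nonneg zero_le_one fun y _ => by positivity
    · refine (hC.integral_rpow_le (by linarith)).trans (le_of_eq ?_)
      rw [show 2 * p + 3 = 2 * p + 2 + 1 by ring, betaFn_add_one,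
        show p ^ 2 + 3 * p + 2 = (p + 1) * (p + 2) by ring]
      have : p + 1 ≠ 0 := by linarith
      have : p + 2 ≠ 0 := by linarith
      field_simp
      ring
  · have h := hC.integral_rpow_le zero_le_one
    have e : ∫ x in (0 : ℝ)..1, x ^ (2 * 1 + 2 : ℝ) * (1 - x) ^ (1 : ℝ) = 1 / 30 := by
      have : ∀ x : ℝ, x ^ (2 * 1 + 2 : ℝ) * (1 - x) ^ (1 : ℝ) = x ^ 4 - x ^ 5 := fun x => by
        rw [show (2 * 1 + 2 : ℝ) = (4 : ℕ) by norm_num, Real.rpow_natCast, Real.rpow_one]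
        ring
      simp only [this]
      rw [intervalIntegral.integral_sub (by simp) (by simp)]
      norm_num [integral_pow]
    rw [e] at h
    simp only [Real.rpow_one] at h
    linarith
  · have h := hC.integral_rpow_le zero_le_two
    have e : ∫ x in (0 : ℝ)..1, x ^ (2 * 2 + 2 : ℝ) * (1 - x) ^ (2 : ℝ) = 1 / 252 := by
      have : ∀ x : ℝ, x ^ (2 * 2 + 2 : ℝ) * (1 - x) ^ (2 : ℝ) = x ^ 6 - 2 * x ^ 7 + x ^ 8 :=
        fun x => by
          rw [show (2 * 2 + 2 : ℝ) = (6 : ℕ) by norm_num, Real.rpow_natCast, Real.rpow_two]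
          ring
      simp only [this]
      rw [intervalIntegral.integral_add (Continuous.intervalIntegrable (by fun_prop) _ _) (by simp),
        intervalIntegral.integral_sub (by simp) (Continuous.intervalIntegrable (by fun_prop) _ _),
        intervalIntegral.integral_const_mul]
      norm_num [integral_pow]
    rw [e] at h
    simp only [Real.rpow_two] at h
    refine Real.sqrt_le_iff.2 ⟨by positivity, h.trans (le_of_eq ?_)⟩
    rw [div_pow, mul_pow, Real.sq_sqrt (by norm_num)]
    norm_num
end

section
/- Let C be a maxmin copula. Then ∫₀¹∫₀¹ |C(x,y) − C(y,x)| dx dy ≤ 2·ln 2 − (2/3)·ln(√5 + 3) + (97 − 47√5)/36, and (∫₀¹∫₀¹ |C(x,y) − C(y,x)|² dx dy)^{1/2} ≤ (1/12)·√(2082 − (3038/3)·√5 + 864·ln(√5 − 1)). -/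
/-- The class `𝓕` of generators: `f : [0,1] → [0,1]`, `f(0) = f(1) = 0`,
`x ↦ f(x) + x` nondecreasing on `[0,1]`, and `x ↦ f(x)/x` nonincreasing on `(0,1]`. -/
def MemF (f : ℝ → ℝ) : Prop :=
  (∀ x ∈ Set.Icc (0:ℝ) 1, f x ∈ Set.Icc (0:ℝ) 1) ∧
  f 0 = 0 ∧ f 1 = 0 ∧
  MonotoneOn (fun x => f x + x) (Set.Icc 0 1) ∧
  AntitoneOn (fun x => f x / x) (Set.Ioc 0 1)

/-- A maxmin copula: `C(x,y) = min{x, xy + f(x)g(1−y)}` on `[0,1]²` with `f, g ∈ 𝓕`. -/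
def IsMaxminCopula (C : ℝ → ℝ → ℝ) : Prop :=
  ∃ f g : ℝ → ℝ, MemF f ∧ MemF g ∧
    ∀ x ∈ Set.Icc (0:ℝ) 1, ∀ y ∈ Set.Icc (0:ℝ) 1,
      C x y = min x (x * y + f x * g (1 - y))

/-- The uniform probability measure on the unit interval. -/
noncomputable def unitVolume : MeasureTheory.Measure ℝ :=
  MeasureTheory.volume.restrict (Set.Icc 0 1)

/-- The `p`-th power of the bound for the asymmetry at `(y, x)`, supported on the triangle
`1 - x ≤ y ≤ x`. -/
noncomputable def triangleBound (p : ℕ) (x y : ℝ) : ℝ :=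
  {q : ℝ × ℝ | 1 - q.1 ≤ q.2 ∧ q.2 ≤ q.1}.indicator
    (fun q => (min (q.2 * (1 - q.1)) (q.2 - q.2 ^ 2 / q.1)) ^ p) (x, y)

open MeasureTheory

section Pointwise

/-- The positive part of the asymmetry at `x ≤ y`, in terms of the values of the generators. -/
lemma min_mul_sub_mul_le {x y u v s t : ℝ} (hy : 0 < y) (hy1 : y ≤ 1) (hxy : x ≤ y)
    (hu0 : 0 ≤ u) (huy : u ≤ y) (hs0 : 0 ≤ s) (hsy : s ≤ y) (hx0 : 0 ≤ x)
    (hv0 : 0 ≤ v) (ht0 : 0 ≤ t) (hv : u - (y - x) ≤ v) (ht : s - (y - x) ≤ t) :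
    min (x * (1 - y)) (u * s) - v * t ≤ x - x ^ 2 / y := by
  have key : ∀ w, 0 ≤ w → w ≤ y → w - (y - x) ≤ v → w * s ≤ x * (1 - y) →
      w * s - v * t ≤ x - x ^ 2 / y := by
    intro w hw0 hwy hwv hws
    have e : x - x ^ 2 / y = (y - x) * x / y := by field_simp
    rw [e, le_div_iff₀ hy]
    have hd : 0 ≤ y - x := by linarith
    have hvt : 0 ≤ v * t := mul_nonneg hv0 ht0
    by_cases hx : x ≤ y ^ 2
    · nlinarith [mul_le_mul_of_nonneg_right hws hy.le, mul_nonneg hvt hy.le, mul_nonneg hd hy.le,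
        mul_nonneg hx0 (sub_nonneg.2 hx)]
    · push Not at hx
      rcases le_total w (y - x) with h | h
      · have h1 : w * s ≤ (y - x) * y := mul_le_mul h hsy hs0 hd
        nlinarith [mul_le_mul_of_nonneg_right h1 hy.le, mul_nonneg hvt hy.le,
          mul_nonneg hd (sub_nonneg.2 hx.le)]
      rcases le_total s (y - x) with h' | h'
      · have h1 : w * s ≤ y * (y - x) := mul_le_mul hwy h' hs0 hy.le
        nlinarith [mul_le_mul_of_nonneg_right h1 hy.le, mul_nonneg hvt hy.le,
          mul_nonneg hd (sub_nonneg.2 hx.le)]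
      · have h1 : (w - (y - x)) * (s - (y - x)) ≤ v * t :=
          mul_le_mul hwv ht (by linarith) hv0
        have h2 : y * (w + s) ≤ y ^ 2 + x * (1 - y) := by
          nlinarith [mul_nonneg (sub_nonneg.2 hwy) (sub_nonneg.2 hsy)]
        nlinarith [mul_le_mul_of_nonneg_left h2 hd, mul_le_mul_of_nonneg_right h1 hy.le]
  by_cases h : u * s ≤ x * (1 - y)
  · rw [min_eq_right h]
    exact key u hu0 huy hv h
  · push Not at h
    rw [min_eq_left h.le]
    have hK : 0 ≤ x * (1 - y) := mul_nonneg hx0 (by linarith)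
    have hs : 0 < s := by
      rcases hs0.eq_or_lt with h0 | h0
      · rw [← h0, mul_zero] at h
        linarith
      · exact h0
    have hw : x * (1 - y) / s ≤ u := by
      rw [div_le_iff₀ hs]
      exact h.le
    have := key (x * (1 - y) / s) (by positivity) (hw.trans huy) (by linarith)
      (by rw [div_mul_cancel₀ _ hs.ne'])
    rwa [div_mul_cancel₀ _ hs.ne'] at this

/-- The negative part of the asymmetry at `x ≤ y`, in terms of the values of the generators. -/
lemma mul_sub_mul_le {x y u v s t : ℝ} (hx : 0 < x) (hxy : x ≤ y) (hy : y < 1)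
    (hv0 : 0 ≤ v) (ht0 : 0 ≤ t) (hv : v ≤ 1 - y) (ht : t ≤ x)
    (hvu : v * x ≤ u * y) (hts : t * (1 - y) ≤ s * (1 - x)) :
    v * t - u * s ≤ x - x ^ 2 / y := by
  have hy0 : 0 < y := hx.trans_le hxy
  have h1 : v * x * (t * (1 - y)) ≤ u * y * (s * (1 - x)) :=
    mul_le_mul hvu hts (mul_nonneg ht0 (by linarith))
      ((mul_nonneg hv0 hx.le).trans hvu)
  have h2 : v * t ≤ (1 - y) * x := mul_le_mul hv ht ht0 (by linarith)
  have e : x - x ^ 2 / y = (y - x) * x / y := by field_simp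
  rw [e, le_div_iff₀ hy0]
  have h3 : (v * t - u * s) * y * (1 - x) ≤ (y - x) * x * (1 - x) := by
    nlinarith [mul_le_mul_of_nonneg_right h2 (sub_nonneg.2 hxy),
      mul_nonneg (mul_nonneg hx.le (sub_nonneg.2 hxy)) (sub_nonneg.2 hxy)]
  exact le_of_mul_le_mul_right h3 (by linarith)

lemma MemF.le_one_sub {f : ℝ → ℝ} (hf : MemF f) {x : ℝ} (hx : x ∈ Set.Icc (0:ℝ) 1) :
    f x ≤ 1 - x := by
  have := hf.2.2.2.1 hx (Set.right_mem_Icc.2 zero_le_one) hx.2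
  simp only [hf.2.2.1] at this
  linarith

lemma MemF.sub_le {f : ℝ → ℝ} (hf : MemF f) {x y : ℝ} (hx : 0 ≤ x) (hxy : x ≤ y) (hy : y ≤ 1) :
    f x - (y - x) ≤ f y := by
  have := hf.2.2.2.1 ⟨hx, hxy.trans hy⟩ ⟨hx.trans hxy, hy⟩ hxy
  simp only at this
  linarith

lemma MemF.mul_le_mul {f : ℝ → ℝ} (hf : MemF f) {x y : ℝ} (hx : 0 < x) (hxy : x ≤ y)
    (hy : y ≤ 1) : f y * x ≤ f x * y := by
  have := hf.2.2.2.2 ⟨hx, hxy.trans hy⟩ ⟨hx.trans_le hxy, hy⟩ hxy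
  simp only at this
  rwa [div_le_div_iff₀ (hx.trans_le hxy) hx] at this

/-- The asymmetry of a maxmin copula at `x ≤ y`, in terms of the values of the generators. -/
lemma abs_min_sub_le {x y u v s t : ℝ} (hx : 0 < x) (hxy : x ≤ y) (hy : y < 1)
    (hsum : 1 ≤ x + y) (hu0 : 0 ≤ u) (hux : u ≤ 1 - x) (hs0 : 0 ≤ s) (hsy : s ≤ y)
    (hv0 : 0 ≤ v) (ht0 : 0 ≤ t) (hv1 : v ≤ 1 - y) (ht1 : t ≤ x)
    (hv : u - (y - x) ≤ v) (ht : s - (y - x) ≤ t)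
    (hvu : v * x ≤ u * y) (hts : t * (1 - y) ≤ s * (1 - x)) :
    |min (x * (1 - y)) (u * s) - v * t| ≤ x - x ^ 2 / y := by
  rw [abs_le]
  constructor
  · have h1 := mul_sub_mul_le hx hxy hy hv0 ht0 hv1 ht1 hvu hts
    have h2 : v * t ≤ (1 - y) * x := _root_.mul_le_mul hv1 ht1 ht0 (by linarith)
    have h3 : 0 ≤ x - x ^ 2 / y := by
      rw [sub_nonneg, div_le_iff₀ (hx.trans_le hxy)]
      nlinarith
    rcases min_choice (x * (1 - y)) (u * s) with h | h <;> rw [h] <;> nlinarith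
  · exact min_mul_sub_mul_le (hx.trans_le hxy) hy.le hxy hu0 (by linarith) hs0 hsy
      hx.le hv0 ht0 hv ht

lemma triangleBound_of_mem (p : ℕ) {x y : ℝ} (h1 : 1 - x ≤ y) (h2 : y ≤ x) :
    triangleBound p x y = (min (y * (1 - x)) (y - y ^ 2 / x)) ^ p :=
  Set.indicator_of_mem (s := {q : ℝ × ℝ | 1 - q.1 ≤ q.2 ∧ q.2 ≤ q.1}) ⟨h1, h2⟩ _

lemma triangleBound_nonneg (p : ℕ) {x y : ℝ} (hx : x ∈ Set.Icc (0:ℝ) 1)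
    (hy : y ∈ Set.Icc (0:ℝ) 1) : 0 ≤ triangleBound p x y := by
  apply Set.indicator_apply_nonneg
  rintro ⟨h1, h2⟩
  refine pow_nonneg (le_min (mul_nonneg hy.1 (by linarith [hx.2])) ?_) _
  rw [sub_nonneg]
  exact div_le_of_le_mul₀ hx.1 hy.1 (by nlinarith [hy.1])

lemma triangleBound_le_one (p : ℕ) {x y : ℝ} (hx : x ∈ Set.Icc (0:ℝ) 1)
    (hy : y ∈ Set.Icc (0:ℝ) 1) : triangleBound p x y ≤ 1 := by
  apply Set.indicator_apply_le' _ (fun _ => zero_le_one)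
  rintro ⟨h1, h2⟩
  refine pow_le_one₀ (le_min (mul_nonneg hy.1 (by linarith [hx.2])) ?_) ?_
  · rw [sub_nonneg]
    exact div_le_of_le_mul₀ hx.1 hy.1 (by nlinarith [hy.1])
  · exact (min_le_left _ _).trans (mul_le_one₀ hy.2 (by linarith [hx.2]) (by linarith [hx.1]))

/-- Above the diagonal, the asymmetry is at most the bound on the relevant triangle, on either
side of the antidiagonal. -/
lemma IsMaxminCopula.abs_sub_pow_le_of_le {C : ℝ → ℝ → ℝ} (hC : IsMaxminCopula C) (p : ℕ)
    {x y : ℝ} (hx : x ∈ Set.Icc (0:ℝ) 1) (hy : y ∈ Set.Icc (0:ℝ) 1) (hxy : x ≤ y) :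
    (1 ≤ x + y → |C x y - C y x| ^ p ≤ triangleBound p y x) ∧
    (x + y ≤ 1 → |C x y - C y x| ^ p ≤ triangleBound p (1 - x) (1 - y)) := by
  obtain ⟨f, g, hf, hg, h⟩ := hC
  have hx' : 1 - x ∈ Set.Icc (0:ℝ) 1 := ⟨by linarith [hx.2], by linarith [hx.1]⟩
  have hy' : 1 - y ∈ Set.Icc (0:ℝ) 1 := ⟨by linarith [hy.2], by linarith [hy.1]⟩
  have hu0 := (hf.1 x hx).1
  have hv0 := (hf.1 y hy).1
  have hs0 := (hg.1 _ hy').1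
  have ht0 := (hg.1 _ hx').1
  have hu1 := hf.le_one_sub hx
  have hv1 := hf.le_one_sub hy
  have hs1 : g (1 - y) ≤ y := by linarith [hg.le_one_sub hy']
  have ht1 : g (1 - x) ≤ x := by linarith [hg.le_one_sub hx']
  have hvt : f y * g (1 - x) ≤ (1 - y) * x := _root_.mul_le_mul hv1 ht1 ht0 hy'.1
  have hK : 0 ≤ x * (1 - y) := mul_nonneg hx.1 hy'.1
  have e1 : C x y = x * y + min (x * (1 - y)) (f x * g (1 - y)) := by
    rw [h x hx y hy, ← min_add_add_left]
    congr 1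
    ring
  have e2 : C y x = x * y + f y * g (1 - x) := by
    rw [h y hy x hx, min_eq_right (by nlinarith)]
    ring
  have e3 : C x y - C y x = min (x * (1 - y)) (f x * g (1 - y)) - f y * g (1 - x) := by
    rw [e1, e2]
    ring
  have b1 : |C x y - C y x| ≤ x * (1 - y) := by
    rw [e3, abs_le]
    have h1 : min (x * (1 - y)) (f x * g (1 - y)) ≤ x * (1 - y) := min_le_left _ _
    have h2 : 0 ≤ min (x * (1 - y)) (f x * g (1 - y)) := le_min hK (mul_nonneg hu0 hs0)
    have h3 : 0 ≤ f y * g (1 - x) := mul_nonneg hv0 ht0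
    constructor <;> linarith
  by_cases hb : x = 0 ∨ y = 1
  · have hz : |C x y - C y x| = 0 := by
      refine le_antisymm (b1.trans_eq ?_) (abs_nonneg _)
      rcases hb with rfl | rfl <;> ring
    constructor
    · intro hsum
      rw [triangleBound_of_mem p (by linarith) hxy]
      refine pow_le_pow_left₀ (abs_nonneg _) (le_min b1 ?_) p
      rw [hz, sub_nonneg]
      exact div_le_of_le_mul₀ hy.1 hx.1 (by nlinarith [hx.1])
    · intro hsum
      rw [triangleBound_of_mem p (by linarith) (by linarith)]
      refine pow_le_pow_left₀ (abs_nonneg _) (le_min (by linarith) ?_) p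
      rw [hz, sub_nonneg]
      exact div_le_of_le_mul₀ hx'.1 hy'.1 (by nlinarith [hy'.1])
  push Not at hb
  have hx0 : 0 < x := lt_of_le_of_ne hx.1 (Ne.symm hb.1)
  have hy1 : y < 1 := lt_of_le_of_ne hy.2 hb.2
  have hv := hf.sub_le hx.1 hxy hy.2
  have ht := hg.sub_le hy'.1 (show 1 - y ≤ 1 - x by linarith) hx'.2
  have hvu := hf.mul_le_mul hx0 hxy hy.2
  have hts := hg.mul_le_mul (show 0 < 1 - y by linarith) (show 1 - y ≤ 1 - x by linarith) hx'.2
  constructor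
  · intro hsum
    rw [triangleBound_of_mem p (by linarith) hxy]
    refine pow_le_pow_left₀ (abs_nonneg _) (le_min b1 ?_) p
    rw [e3]
    exact abs_min_sub_le hx0 hxy hy1 hsum hu0 hu1 hs0 hs1 hv0 ht0 hv1 ht1 hv (by linarith) hvu hts
  · intro hsum
    rw [triangleBound_of_mem p (by linarith) (by linarith)]
    refine pow_le_pow_left₀ (abs_nonneg _) (le_min (by linarith) ?_) p
    rw [e3]
    have := abs_min_sub_le (x := 1 - y) (y := 1 - x) (u := g (1 - y)) (v := g (1 - x))
      (s := f x) (t := f y) (by linarith) (by linarith) (by linarith) (by linarith) hs0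
      (by linarith) hu0 hu1 ht0 hv0 (by linarith) hv1 (by linarith) (by linarith) hts
      (by linarith)
    rwa [sub_sub_cancel, mul_comm (1 - y), mul_comm (g _), mul_comm (g _)] at this

lemma IsMaxminCopula.abs_sub_pow_le {C : ℝ → ℝ → ℝ} (hC : IsMaxminCopula C) (p : ℕ)
    {x y : ℝ} (hx : x ∈ Set.Icc (0:ℝ) 1) (hy : y ∈ Set.Icc (0:ℝ) 1) :
    |C x y - C y x| ^ p ≤ triangleBound p x y + triangleBound p y x +
      triangleBound p (1 - x) (1 - y) + triangleBound p (1 - y) (1 - x) := by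
  have hx' : 1 - x ∈ Set.Icc (0:ℝ) 1 := ⟨by linarith [hx.2], by linarith [hx.1]⟩
  have hy' : 1 - y ∈ Set.Icc (0:ℝ) 1 := ⟨by linarith [hy.2], by linarith [hy.1]⟩
  have h1 := triangleBound_nonneg p hx hy
  have h2 := triangleBound_nonneg p hy hx
  have h3 := triangleBound_nonneg p hx' hy'
  have h4 := triangleBound_nonneg p hy' hx'
  rcases le_total x y with h | h
  · have := hC.abs_sub_pow_le_of_le p hx hy h
    rcases le_total 1 (x + y) with h' | h'
    · linarith [this.1 h']
    · linarith [this.2 h']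
  · have := hC.abs_sub_pow_le_of_le p hy hx h
    rw [abs_sub_comm (C x y)]
    rcases le_total 1 (y + x) with h' | h'
    · linarith [this.1 h']
    · linarith [this.2 h']

end Pointwise

section Integration

instance : IsProbabilityMeasure unitVolume := ⟨by simp [unitVolume]⟩

lemma measurable_triangleBound (p : ℕ) :
    Measurable (fun q : ℝ × ℝ => triangleBound p q.1 q.2) := by
  unfold triangleBound
  refine Measurable.indicator (by fun_prop) ?_
  exact (measurableSet_le (measurable_const.sub measurable_fst) measurable_snd).inter
    (measurableSet_le measurable_snd measurable_fst)

lemma ae_mem_unitVolume : ∀ᵐ x ∂unitVolume, x ∈ Set.Icc (0:ℝ) 1 :=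
  ae_restrict_mem measurableSet_Icc

lemma ae_mem_unitVolume_prod :
    ∀ᵐ q ∂unitVolume.prod unitVolume, q.1 ∈ Set.Icc (0:ℝ) 1 ∧ q.2 ∈ Set.Icc (0:ℝ) 1 := by
  rw [unitVolume, Measure.prod_restrict]
  exact ae_restrict_mem (measurableSet_Icc.prod measurableSet_Icc)

lemma integral_unitVolume (F : ℝ → ℝ) : ∫ x, F x ∂unitVolume = ∫ x in (0:ℝ)..1, F x := by
  rw [unitVolume, integral_Icc_eq_integral_Ioc, intervalIntegral.integral_of_le zero_le_one]

lemma integral_unitVolume_one_sub (F : ℝ → ℝ) :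
    ∫ x, F (1 - x) ∂unitVolume = ∫ x, F x ∂unitVolume := by
  rw [integral_unitVolume, integral_unitVolume, intervalIntegral.integral_comp_sub_left]
  norm_num

/-- A function on the unit square bounded by the four symmetric copies of `T` has integral at most
four times that of `T`. -/
lemma integral_integral_le_four_mul {F T : ℝ → ℝ → ℝ}
    (hT : Measurable fun q : ℝ × ℝ => T q.1 q.2)
    (hT0 : ∀ x ∈ Set.Icc (0:ℝ) 1, ∀ y ∈ Set.Icc (0:ℝ) 1, 0 ≤ T x y)
    (hT1 : ∀ x ∈ Set.Icc (0:ℝ) 1, ∀ y ∈ Set.Icc (0:ℝ) 1, T x y ≤ 1)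
    (hF0 : ∀ x y, 0 ≤ F x y)
    (hF : ∀ x ∈ Set.Icc (0:ℝ) 1, ∀ y ∈ Set.Icc (0:ℝ) 1,
      F x y ≤ T x y + T y x + T (1 - x) (1 - y) + T (1 - y) (1 - x)) :
    ∫ x, ∫ y, F x y ∂unitVolume ∂unitVolume ≤
      4 * ∫ x, ∫ y, T x y ∂unitVolume ∂unitVolume := by
  have hsub : ∀ x ∈ Set.Icc (0:ℝ) 1, 1 - x ∈ Set.Icc (0:ℝ) 1 := fun x hx =>
    ⟨by linarith [hx.2], by linarith [hx.1]⟩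
  have int : ∀ a b : ℝ × ℝ → ℝ, Measurable a → Measurable b →
      (∀ q : ℝ × ℝ, q.1 ∈ Set.Icc (0:ℝ) 1 ∧ q.2 ∈ Set.Icc (0:ℝ) 1 →
        a q ∈ Set.Icc (0:ℝ) 1 ∧ b q ∈ Set.Icc (0:ℝ) 1) →
      Integrable (fun q => T (a q) (b q)) (unitVolume.prod unitVolume) := by
    intro a b ha hb hab
    refine Integrable.of_bound (hT.comp (ha.prodMk hb)).aestronglyMeasurable 1 ?_
    filter_upwards [ae_mem_unitVolume_prod] with q hq
    rw [Real.norm_eq_abs, abs_of_nonneg (hT0 _ (hab q hq).1 _ (hab q hq).2)]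
    exact hT1 _ (hab q hq).1 _ (hab q hq).2
  have i1 := int (fun q => q.1) (fun q => q.2) (by fun_prop) (by fun_prop) fun q hq => hq
  have i2 := int (fun q => q.2) (fun q => q.1) (by fun_prop) (by fun_prop) fun q hq => hq.symm
  have i3 := int (fun q => 1 - q.1) (fun q => 1 - q.2) (by fun_prop) (by fun_prop)
    fun q hq => ⟨hsub _ hq.1, hsub _ hq.2⟩
  have i4 := int (fun q => 1 - q.2) (fun q => 1 - q.1) (by fun_prop) (by fun_prop)
    fun q hq => ⟨hsub _ hq.2, hsub _ hq.1⟩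
  have i12 := i1.add i2
  have i123 := i12.add i3
  have i1234 := i123.add i4
  have e3 : ∫ q : ℝ × ℝ, T (1 - q.1) (1 - q.2) ∂unitVolume.prod unitVolume =
      ∫ x, ∫ y, T x y ∂unitVolume ∂unitVolume := by
    rw [integral_prod _ i3]
    simp only [integral_unitVolume_one_sub (T _)]
    exact integral_unitVolume_one_sub fun x => ∫ y, T x y ∂unitVolume
  have e4 : ∫ q : ℝ × ℝ, T (1 - q.2) (1 - q.1) ∂unitVolume.prod unitVolume =
      ∫ x, ∫ y, T x y ∂unitVolume ∂unitVolume := by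
    rw [← e3, ← integral_prod_swap]
    rfl
  have e1 : ∫ q : ℝ × ℝ, T q.1 q.2 ∂unitVolume.prod unitVolume =
      ∫ x, ∫ y, T x y ∂unitVolume ∂unitVolume := integral_prod _ i1
  have e2 : ∫ q : ℝ × ℝ, T q.2 q.1 ∂unitVolume.prod unitVolume =
      ∫ x, ∫ y, T x y ∂unitVolume ∂unitVolume := by
    rw [← e1, ← integral_prod_swap]
    rfl
  have total := integral_add' i123 i4
  rw [integral_add' i12 i3, integral_add' i1 i2, e1, e2, e3, e4] at total
  calc ∫ x, ∫ y, F x y ∂unitVolume ∂unitVolume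
      ≤ ∫ x, ∫ y, (T x y + T y x + T (1 - x) (1 - y) + T (1 - y) (1 - x))
          ∂unitVolume ∂unitVolume := by
        refine integral_mono_of_nonneg (ae_of_all _ fun x => integral_nonneg (hF0 x))
          i1234.integral_prod_left ?_
        filter_upwards [ae_mem_unitVolume] with x hx
        refine integral_mono_of_nonneg (ae_of_all _ (hF0 x)) ?_ ?_
        · have intx : ∀ a b : ℝ → ℝ, Measurable a → Measurable b →
              (∀ y ∈ Set.Icc (0:ℝ) 1, a y ∈ Set.Icc (0:ℝ) 1 ∧ b y ∈ Set.Icc (0:ℝ) 1) →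
              Integrable (fun y => T (a y) (b y)) unitVolume := by
            intro a b ha hb hab
            refine Integrable.of_bound (hT.comp (ha.prodMk hb)).aestronglyMeasurable 1 ?_
            filter_upwards [ae_mem_unitVolume] with y hy
            rw [Real.norm_eq_abs, abs_of_nonneg (hT0 _ (hab y hy).1 _ (hab y hy).2)]
            exact hT1 _ (hab y hy).1 _ (hab y hy).2
          exact (((intx (fun _ => x) (fun y => y) (by fun_prop) (by fun_prop)
              fun y hy => ⟨hx, hy⟩).add
            (intx (fun y => y) (fun _ => x) (by fun_prop) (by fun_prop)
              fun y hy => ⟨hy, hx⟩)).add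
            (intx (fun _ => 1 - x) (fun y => 1 - y) (by fun_prop) (by fun_prop)
              fun y hy => ⟨hsub _ hx, hsub _ hy⟩)).add
            (intx (fun y => 1 - y) (fun _ => 1 - x) (by fun_prop) (by fun_prop)
              fun y hy => ⟨hsub _ hy, hsub _ hx⟩)
        · filter_upwards [ae_mem_unitVolume] with y hy using hF x hx y hy
    _ = 4 * ∫ x, ∫ y, T x y ∂unitVolume ∂unitVolume := by
        refine (integral_prod _ i1234).symm.trans (total.trans ?_)
        ring

lemma integral_triangleBound_of_lt (p : ℕ) {x : ℝ} (hx : x < 1 / 2) :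
    ∫ y, triangleBound p x y ∂unitVolume = 0 := by
  have : ∀ y, triangleBound p x y = 0 := fun y =>
    Set.indicator_of_notMem (fun h => by linarith [h.1, h.2]) _
  simp [this]

lemma integral_triangleBound (p : ℕ) {x : ℝ} (hx : 1 / 2 ≤ x) (hx1 : x ≤ 1) :
    ∫ y, triangleBound p x y ∂unitVolume =
      ∫ y in (1 - x)..x, (min (y * (1 - x)) (y - y ^ 2 / x)) ^ p := by
  have e : ∀ y, triangleBound p x y = (Set.Icc (1 - x) x).indicator
      (fun y => (min (y * (1 - x)) (y - y ^ 2 / x)) ^ p) y := fun _ => rfl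
  simp only [e]
  rw [unitVolume, setIntegral_indicator measurableSet_Icc,
    Set.inter_eq_right.2 (Set.Icc_subset_Icc (by linarith) hx1), integral_Icc_eq_integral_Ioc,
    intervalIntegral.integral_of_le (by linarith)]

lemma integral_triangleBound_of_sq_le (p : ℕ) {x : ℝ} (hx : 1 / 2 ≤ x) (hx1 : x ≤ 1)
    (h : x ^ 2 ≤ 1 - x) :
    ∫ y, triangleBound p x y ∂unitVolume = ∫ y in (1 - x)..x, (y - y ^ 2 / x) ^ p := by
  rw [integral_triangleBound p hx hx1]
  refine intervalIntegral.integral_congr fun y hy => ?_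
  rw [Set.uIcc_of_le (by linarith)] at hy
  rw [min_eq_right]
  have : y * x ≤ y ^ 2 / x := by
    rw [le_div_iff₀ (by linarith)]
    nlinarith [hy.1, hy.2]
  linarith

lemma integral_triangleBound_of_le_sq (p : ℕ) {x : ℝ} (hx : 1 / 2 ≤ x) (hx1 : x ≤ 1)
    (h : 1 - x ≤ x ^ 2) :
    ∫ y, triangleBound p x y ∂unitVolume =
      (∫ y in (1 - x)..x ^ 2, (y * (1 - x)) ^ p) + ∫ y in (x ^ 2)..x, (y - y ^ 2 / x) ^ p := by
  have hc : Continuous fun y : ℝ => (min (y * (1 - x)) (y - y ^ 2 / x)) ^ p := by fun_prop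
  rw [integral_triangleBound p hx hx1, ← intervalIntegral.integral_add_adjacent_intervals
    (hc.intervalIntegrable _ (x ^ 2)) (hc.intervalIntegrable _ _)]
  congr 1
  · refine intervalIntegral.integral_congr fun y hy => ?_
    rw [Set.uIcc_of_le h] at hy
    rw [min_eq_left]
    have : y ^ 2 / x ≤ y * x := by
      rw [div_le_iff₀ (by linarith)]
      nlinarith [hy.1, hy.2]
    linarith
  · refine intervalIntegral.integral_congr fun y hy => ?_
    rw [Set.uIcc_of_le (by nlinarith)] at hy
    rw [min_eq_right]
    have : y * x ≤ y ^ 2 / x := by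
      rw [le_div_iff₀ (by linarith)]
      nlinarith [hy.1, hy.2, sq_nonneg x]
    linarith

/-- The integral of the bound over its triangle, from antiderivatives of the inner integrals on
either side of the root `r` of `r ^ 2 = 1 - r`. -/
lemma integral_integral_triangleBound (p : ℕ) {r : ℝ} {G H G' H' : ℝ → ℝ} (hr : 1 / 2 ≤ r)
    (hr1 : r ≤ 1) (hr2 : r ^ 2 = 1 - r)
    (hG : ∀ x ∈ Set.Icc (1 / 2) r, HasDerivAt G (G' x) x)
    (hH : ∀ x ∈ Set.Icc r 1, HasDerivAt H (H' x) x)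
    (hG' : ∀ x ∈ Set.Icc (1 / 2) r, ∫ y in (1 - x)..x, (y - y ^ 2 / x) ^ p = G' x)
    (hH' : ∀ x ∈ Set.Icc r 1, (∫ y in (1 - x)..x ^ 2, (y * (1 - x)) ^ p) +
      ∫ y in (x ^ 2)..x, (y - y ^ 2 / x) ^ p = H' x) :
    ∫ x, ∫ y, triangleBound p x y ∂unitVolume ∂unitVolume = G r - G (1 / 2) + (H 1 - H r) := by
  set I : ℝ → ℝ := fun x => ∫ y, triangleBound p x y ∂unitVolume with hI
  have hint : Integrable I unitVolume := by
    refine Integrable.integral_prod_left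
      (f := fun q : ℝ × ℝ => triangleBound p q.1 q.2) (Integrable.of_bound
      (measurable_triangleBound p).aestronglyMeasurable 1 ?_)
    filter_upwards [ae_mem_unitVolume_prod] with q hq
    rw [Real.norm_eq_abs, abs_of_nonneg (triangleBound_nonneg p hq.1 hq.2)]
    exact triangleBound_le_one p hq.1 hq.2
  have hsub : ∀ a b, 0 ≤ a → a ≤ b → b ≤ 1 → IntervalIntegrable I volume a b := by
    intro a b ha hab hb
    rw [intervalIntegrable_iff_integrableOn_Icc_of_le hab]
    exact IntegrableOn.mono_set hint (Set.Icc_subset_Icc ha hb)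
  have i0 := hsub 0 (1 / 2) le_rfl (by norm_num) (by norm_num)
  have i1 := hsub (1 / 2) r (by norm_num) hr hr1
  have i2 := hsub r 1 (by linarith) hr1 le_rfl
  rw [integral_unitVolume, ← intervalIntegral.integral_add_adjacent_intervals (i0.trans i1) i2,
    ← intervalIntegral.integral_add_adjacent_intervals i0 i1]
  have c0 : ∫ x in (0:ℝ)..(1 / 2), I x = 0 := by
    rw [intervalIntegral.integral_of_le (by norm_num), integral_Ioc_eq_integral_Ioo]
    exact setIntegral_eq_zero_of_forall_eq_zero fun x hx => integral_triangleBound_of_lt p hx.2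
  have c1 : ∀ x ∈ Set.Icc (1 / 2) r, I x = G' x := fun x hx => by
    rw [← hG' x hx]
    exact integral_triangleBound_of_sq_le p hx.1 (hx.2.trans hr1) (by nlinarith [hx.1, hx.2])
  have c2 : ∀ x ∈ Set.Icc r 1, I x = H' x := fun x hx => by
    rw [← hH' x hx]
    exact integral_triangleBound_of_le_sq p (hr.trans hx.1) hx.2 (by nlinarith [hx.1, hx.2])
  rw [← Set.uIcc_of_le hr] at hG c1
  rw [← Set.uIcc_of_le hr1] at hH c2
  rw [c0, zero_add]
  congr 1
  · exact intervalIntegral.integral_eq_sub_of_hasDerivAt (fun x hx => c1 x hx ▸ hG x hx) i1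
  · exact intervalIntegral.integral_eq_sub_of_hasDerivAt (fun x hx => c2 x hx ▸ hH x hx) i2

lemma integral_sub_sq_div (a b x : ℝ) :
    ∫ y in a..b, (y - y ^ 2 / x) ^ 1 = (b ^ 2 - a ^ 2) / 2 - (b ^ 3 - a ^ 3) / (3 * x) := by
  have : ∀ y ∈ Set.uIcc a b, HasDerivAt (fun y : ℝ => y ^ 2 / 2 - y ^ 3 / 3 / x)
      ((y - y ^ 2 / x) ^ 1) y := fun y _ => by
    refine HasDerivAt.congr_deriv
      (((hasDerivAt_pow 2 y).div_const 2).sub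
        (((hasDerivAt_pow 3 y).div_const 3).div_const x)) ?_
    norm_num
  rw [intervalIntegral.integral_eq_sub_of_hasDerivAt this
    (Continuous.intervalIntegrable (by fun_prop) _ _)]
  ring

lemma integral_sub_sq_div_sq (a b x : ℝ) :
    ∫ y in a..b, (y - y ^ 2 / x) ^ 2 = (b ^ 3 - a ^ 3) / 3 - (b ^ 4 - a ^ 4) / (2 * x) +
      (b ^ 5 - a ^ 5) / (5 * x ^ 2) := by
  have : ∀ y ∈ Set.uIcc a b, HasDerivAt
      (fun y : ℝ => y ^ 3 / 3 - y ^ 4 / 2 / x + y ^ 5 / 5 / x ^ 2)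
      ((y - y ^ 2 / x) ^ 2) y := fun y _ => by
    refine HasDerivAt.congr_deriv
      ((((hasDerivAt_pow 3 y).div_const 3).sub
      (((hasDerivAt_pow 4 y).div_const 2).div_const x)).add
      (((hasDerivAt_pow 5 y).div_const 5).div_const (x ^ 2))) ?_
    norm_num
    ring
  rw [intervalIntegral.integral_eq_sub_of_hasDerivAt this
    (Continuous.intervalIntegrable (by fun_prop) _ _)]
  ring

lemma integral_mul_const_pow (p : ℕ) (a b c : ℝ) :
    ∫ y in a..b, (y * c) ^ p = (b ^ (p + 1) - a ^ (p + 1)) / (p + 1) * c ^ p := by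
  simp only [mul_pow]
  rw [intervalIntegral.integral_mul_const, integral_pow]

lemma integral_integral_triangleBound_one {r : ℝ} (hr : 1 / 2 ≤ r) (hr1 : r ≤ 1)
    (hr2 : r ^ 2 = 1 - r) :
    ∫ x, ∫ y, triangleBound 1 x y ∂unitVolume ∂unitVolume =
      Real.log (2 * r) / 3 + (97 / 36 - 47 * (2 * r + 1) / 36) / 4 := by
  rw [integral_integral_triangleBound 1
    (G := fun x => -2 / 9 * x ^ 3 + x ^ 2 - 3 / 2 * x + 1 / 3 * Real.log x)
    (G' := fun x => -2 / 3 * x ^ 2 + 2 * x - 3 / 2 + 1 / 3 * x⁻¹)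
    (H := fun x => -1 / 36 * x ^ 6 + 1 / 8 * x ^ 4 - 4 / 9 * x ^ 3 + 3 / 4 * x ^ 2 - 1 / 2 * x)
    (H' := fun x => -1 / 6 * x ^ 5 + 1 / 2 * x ^ 3 - 4 / 3 * x ^ 2 + 3 / 2 * x - 1 / 2)
    hr hr1 hr2]
  · have h3 : r ^ 3 = 2 * r - 1 := by linear_combination (r - 1) * hr2
    have h4 : r ^ 4 = 2 - 3 * r := by linear_combination r * h3 + 2 * hr2
    have h6 : r ^ 6 = 5 - 8 * r := by linear_combination r ^ 2 * h4 - 3 * h3 + 2 * hr2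
    have hl : Real.log (2 * r) = Real.log r - Real.log (1 / 2) := by
      rw [Real.log_mul two_ne_zero (by positivity), one_div, Real.log_inv]
      ring
    simp only [hl, h3, h4, h6, hr2]
    ring
  · intro x hx
    have hx0 : x ≠ 0 := by linarith [hx.1]
    refine HasDerivAt.congr_deriv
      (((((hasDerivAt_pow 3 x).const_mul (-2 / 9)).add (hasDerivAt_pow 2 x)).sub
      ((hasDerivAt_id' x).const_mul (3 / 2))).add
      ((Real.hasDerivAt_log hx0).const_mul (1 / 3))) ?_
    norm_num
    ring
  · intro x hx
    refine HasDerivAt.congr_deriv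
      ((((((hasDerivAt_pow 6 x).const_mul (-1 / 36)).add
      ((hasDerivAt_pow 4 x).const_mul (1 / 8))).sub
      ((hasDerivAt_pow 3 x).const_mul (4 / 9))).add
      ((hasDerivAt_pow 2 x).const_mul (3 / 4))).sub
      ((hasDerivAt_id' x).const_mul (1 / 2))) ?_
    norm_num
    ring
  · intro x hx
    have hx0 : x ≠ 0 := by linarith [hx.1]
    rw [integral_sub_sq_div]
    field_simp
    ring
  · intro x hx
    have hx0 : x ≠ 0 := by linarith [hx.1]
    rw [integral_sub_sq_div, integral_mul_const_pow]
    push_cast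
    field_simp
    ring

lemma integral_integral_triangleBound_two {r : ℝ} (hr : 1 / 2 ≤ r) (hr1 : r ≤ 1)
    (hr2 : r ^ 2 = 1 - r) :
    ∫ x, ∫ y, triangleBound 2 x y ∂unitVolume ∂unitVolume =
      (2082 - (3038 / 3) * (2 * r + 1) + 864 * Real.log (2 * r)) / 576 := by
  rw [integral_integral_triangleBound 2
    (G := fun x => 4 / 15 * x ^ 4 - 4 / 3 * x ^ 3 + 3 * x ^ 2 - 13 / 3 * x
      + 3 / 2 * Real.log x + 1 / 5 * x⁻¹)
    (G' := fun x => 16 / 15 * x ^ 3 - 4 * x ^ 2 + 6 * x - 13 / 3 + 3 / 2 * x⁻¹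
      - 1 / 5 * (x ^ 2)⁻¹)
    (H := fun x => 2 / 135 * x ^ 9 - 1 / 48 * x ^ 8 + 1 / 120 * x ^ 4 + 1 / 18 * (1 - x) ^ 6)
    (H' := fun x => 2 / 15 * x ^ 8 - 1 / 6 * x ^ 7 + 1 / 30 * x ^ 3 - 1 / 3 * (1 - x) ^ 5)
    hr hr1 hr2]
  · have h3 : r ^ 3 = 2 * r - 1 := by linear_combination (r - 1) * hr2
    have h4 : r ^ 4 = 2 - 3 * r := by linear_combination r * h3 + 2 * hr2
    have h8 : r ^ 8 = 13 - 21 * r := by linear_combination (r ^ 4 + 2 - 3 * r) * h4 + 9 * hr2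
    have h9 : r ^ 9 = 34 * r - 21 := by linear_combination r * h8 - 21 * hr2
    have h12 : (1 - r) ^ 6 = 89 - 144 * r := by
      rw [← hr2]
      linear_combination r ^ 3 * h9 + 34 * h4 - 21 * h3
    have hi : r⁻¹ = r + 1 := inv_eq_of_mul_eq_one_right (by linear_combination hr2)
    have hl : Real.log (2 * r) = Real.log r - Real.log (1 / 2) := by
      rw [Real.log_mul two_ne_zero (by positivity), one_div, Real.log_inv]
      ring
    simp only [hl, h3, h4, h8, h9, h12, hr2, hi]
    ring
  · intro x hx
    have hx0 : x ≠ 0 := by linarith [hx.1]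
    refine HasDerivAt.congr_deriv
      (((((((hasDerivAt_pow 4 x).const_mul (4 / 15)).sub
      ((hasDerivAt_pow 3 x).const_mul (4 / 3))).add
      ((hasDerivAt_pow 2 x).const_mul 3)).sub
      ((hasDerivAt_id' x).const_mul (13 / 3))).add
      ((Real.hasDerivAt_log hx0).const_mul (3 / 2))).add
      ((hasDerivAt_inv hx0).const_mul (1 / 5))) ?_
    norm_num
    ring
  · intro x hx
    refine HasDerivAt.congr_deriv
      (((((hasDerivAt_pow 9 x).const_mul (2 / 135)).sub
      ((hasDerivAt_pow 8 x).const_mul (1 / 48))).add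
      ((hasDerivAt_pow 4 x).const_mul (1 / 120))).add
      ((((hasDerivAt_id' x).const_sub 1).pow 6).const_mul (1 / 18))) ?_
    norm_num
    ring
  · intro x hx
    have hx0 : x ≠ 0 := by linarith [hx.1]
    rw [integral_sub_sq_div_sq]
    field_simp
    ring
  · intro x hx
    have hx0 : x ≠ 0 := by linarith [hx.1]
    rw [integral_sub_sq_div_sq, integral_mul_const_pow]
    push_cast
    field_simp
    ring

lemma IsMaxminCopula.integral_abs_sub_pow_le {C : ℝ → ℝ → ℝ} (hC : IsMaxminCopula C) (p : ℕ) :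
    (∫ x in (0:ℝ)..1, ∫ y in (0:ℝ)..1, |C x y - C y x| ^ p) ≤
      4 * ∫ x, ∫ y, triangleBound p x y ∂unitVolume ∂unitVolume := by
  simp only [← integral_unitVolume]
  exact integral_integral_le_four_mul (measurable_triangleBound p)
    (fun _ hx _ hy => triangleBound_nonneg p hx hy)
    (fun _ hx _ hy => triangleBound_le_one p hx hy) (fun _ _ => by positivity)
    (fun _ hx _ hy => hC.abs_sub_pow_le p hx hy)

end Integration

/-- Observation 5.9: for a maxmin copula `C`,
`μ₁(C) ≤ 2 ln 2 − (2/3) ln(√5+3) + (97 − 47√5)/36` and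
`μ₂(C) ≤ (1/12)√(2082 − (3038/3)√5 + 864 ln(√5 − 1))`. -/
theorem maxmin_mu_one_and_mu_two_bounds (C : ℝ → ℝ → ℝ) (hC : IsMaxminCopula C) :
    (∫ x in (0:ℝ)..1, ∫ y in (0:ℝ)..1, |C x y - C y x|) ≤
      2 * Real.log 2 - (2 / 3) * Real.log (Real.sqrt 5 + 3) +
        (97 - 47 * Real.sqrt 5) / 36 ∧
    Real.sqrt (∫ x in (0:ℝ)..1, ∫ y in (0:ℝ)..1, |C x y - C y x| ^ 2) ≤
      (1 / 12) * Real.sqrt (2082 - (3038 / 3) * Real.sqrt 5 +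
        864 * Real.log (Real.sqrt 5 - 1)) := by
  have h5 : Real.sqrt 5 ^ 2 = 5 := Real.sq_sqrt (by norm_num)
  have h2 : 2 ≤ Real.sqrt 5 := Real.le_sqrt_of_sq_le (by norm_num)
  have h3 : Real.sqrt 5 ≤ 3 := Real.sqrt_le_iff.2 ⟨by norm_num, by norm_num⟩
  obtain ⟨r, hr⟩ : ∃ r, Real.sqrt 5 = 2 * r + 1 := ⟨(Real.sqrt 5 - 1) / 2, by ring⟩
  rw [hr] at h2 h3 h5 ⊢
  have hr2 : r ^ 2 = 1 - r := by linear_combination h5 / 4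
  have b1 := hC.integral_abs_sub_pow_le 1
  have b2 := hC.integral_abs_sub_pow_le 2
  rw [integral_integral_triangleBound_one (by linarith) (by linarith) hr2] at b1
  rw [integral_integral_triangleBound_two (by linarith) (by linarith) hr2] at b2
  constructor
  · simp only [pow_one] at b1
    have hr0 : 0 < r := by linarith
    have hl : Real.log (2 * r + 1 + 3) = 3 * Real.log 2 - 2 * Real.log (2 * r) := by
      have e : 2 * r + 1 + 3 = 2 ^ 3 / (2 * r) ^ 2 := by
        rw [eq_div_iff (by positivity)]
        linear_combination (8 * r + 8) * hr2
      rw [e, Real.log_div (by positivity) (by positivity), Real.log_pow, Real.log_pow]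
      norm_num
    rw [hl]
    linarith
  · have e : (1 / 12 : ℝ) = Real.sqrt (1 / 144) := by
      rw [show (1 / 144 : ℝ) = (1 / 12) ^ 2 by norm_num, Real.sqrt_sq (by norm_num)]
    rw [e, ← Real.sqrt_mul (by norm_num), add_sub_cancel_right]
    exact Real.sqrt_le_sqrt (by linarith)
end
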